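/- Let B₄ be the presented group on generators σ₁, σ₂, σ₃ with the braid relations, let G be the subgroup of B₄ generated by τ = σ₁σ₂σ₃ and Δ = σ₁σ₂σ₃σ₁σ₂σ₁, and let Z be the central subgroup of B₄ generated by θ = τ⁴ = Δ² (the center of B₄). Then the quotient group G/Z is isomorphic to the free product (ℤ/4ℤ) * (ℤ/2ℤ); equivalently, G/Z has the presentation ⟨τ, Δ | τ⁴ = Δ² = 1⟩. -/

import Mathlib

open LaurentPolynomial

/-- The braid relators of `B₄` in the free group on three generators. -/
def braidRels : Set (FreeGroup (Fin 3)) :=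
  { FreeGroup.of 0 * FreeGroup.of 1 * FreeGroup.of 0 *
      (FreeGroup.of 1 * FreeGroup.of 0 * FreeGroup.of 1)⁻¹,
    FreeGroup.of 1 * FreeGroup.of 2 * FreeGroup.of 1 *
      (FreeGroup.of 2 * FreeGroup.of 1 * FreeGroup.of 2)⁻¹,
    FreeGroup.of 0 * FreeGroup.of 2 * (FreeGroup.of 2 * FreeGroup.of 0)⁻¹ }

/-- The braid group `B₄`, presented on `σ₁, σ₂, σ₃` with the braid relations. -/
abbrev B₄ : Type := PresentedGroup braidRels

/-- The standard generators `σ₁, σ₂, σ₃` of `B₄` (indexed by `Fin 3`). -/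
def σ (i : Fin 3) : B₄ := PresentedGroup.of i

/-- `t` in the Laurent polynomial ring `ℤ[t,t⁻¹]`. -/
noncomputable def tt : LaurentPolynomial ℤ := T 1

/-- Reduced Burau matrix of `σ₁`. -/
noncomputable def M₁ : Matrix (Fin 3) (Fin 3) (LaurentPolynomial ℤ) :=
  !![-tt, tt, 0; 0, 1, 0; 0, 0, 1]

/-- Reduced Burau matrix of `σ₂`. -/
noncomputable def M₂ : Matrix (Fin 3) (Fin 3) (LaurentPolynomial ℤ) :=
  !![1, 0, 0; 1, -tt, tt; 0, 0, 1]

/-- Reduced Burau matrix of `σ₃`. -/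
noncomputable def M₃ : Matrix (Fin 3) (Fin 3) (LaurentPolynomial ℤ) :=
  !![1, 0, 0; 0, 1, 0; 0, 1, -tt]

/-- `α = σ₁σ₂σ₃⁻¹σ₁σ₂⁻¹σ₁⁻¹`. -/
def α : B₄ := σ 0 * σ 1 * (σ 2)⁻¹ * σ 0 * (σ 1)⁻¹ * (σ 0)⁻¹

/-- `β = σ₃σ₁⁻¹`. -/
def β : B₄ := σ 2 * (σ 0)⁻¹

/-- `τ = σ₁σ₂σ₃`. -/
def τ : B₄ := σ 0 * σ 1 * σ 2

/-- `Δ = σ₁σ₂σ₃σ₁σ₂σ₁`. -/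
def Δ : B₄ := σ 0 * σ 1 * σ 2 * σ 0 * σ 1 * σ 0

/-- `θ = τ⁴`, the full twist generating the center of `B₄`. -/
def θ : B₄ := τ ^ 4

/-- The subgroup `G = ⟨τ, Δ⟩` of `B₄`. -/
def Gsub : Subgroup B₄ := Subgroup.closure ({τ, Δ} : Set B₄)

/-- A word commuting with every generator of a free group on at least two generators is trivial. -/
theorem FreeGroup.eq_one_of_forall_commute_of {ι : Type*} [DecidableEq ι] [Nontrivial ι]
    {w : FreeGroup ι} (h : ∀ i, FreeGroup.of i * w = w * FreeGroup.of i) : w = 1 := by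
  rw [← FreeGroup.toWord_eq_nil_iff]
  rcases hw : w.toWord with _ | ⟨⟨j, e⟩, L⟩
  · rfl
  exfalso
  obtain ⟨i, hij⟩ := exists_ne j
  have hred : FreeGroup.IsReduced ((i, true) :: w.toWord) := by
    have := FreeGroup.isReduced_toWord (x := w)
    rw [hw] at this ⊢
    exact FreeGroup.isReduced_cons_cons.2 ⟨fun hh => absurd hh hij, this⟩
  have hword := congrArg FreeGroup.toWord (h i)
  rw [FreeGroup.toWord_mul, FreeGroup.toWord_mul, FreeGroup.toWord_of, List.singleton_append,
    hred.reduce_eq] at hword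
  have hsub : ((i, true) :: w.toWord).Sublist (w.toWord ++ [(i, true)]) := by
    rw [hword]
    exact FreeGroup.Red.sublist FreeGroup.reduce.red
  have heq := hsub.eq_of_length (by simp)
  rw [hw, List.cons_append, List.cons.injEq, Prod.mk.injEq] at heq
  exact hij heq.1.1

/-- The homomorphism from the cyclic group of order `n` determined by an element with
`g ^ n = 1`. -/
def zmodPowHom {H : Type*} [Group H] (n : ℕ) (g : H) (hg : g ^ n = 1) :
    Multiplicative (ZMod n) →* H :=
  AddMonoidHom.toMultiplicativeLeft
    (ZMod.lift n ⟨zmultiplesHom (Additive H) (Additive.ofMul g), by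
      rw [zmultiplesHom_apply, natCast_zsmul, ← ofMul_pow, hg, ofMul_one]⟩)

theorem zmodPowHom_ofAdd_one {H : Type*} [Group H] (n : ℕ) (g : H) (hg : g ^ n = 1) :
    zmodPowHom n g hg (Multiplicative.ofAdd 1) = g := by
  have := ZMod.lift_coe n ⟨zmultiplesHom (Additive H) (Additive.ofMul g), by
      rw [zmultiplesHom_apply, natCast_zsmul, ← ofMul_pow, hg, ofMul_one]⟩ 1
  simp only [Int.cast_one, zmultiplesHom_apply, one_zsmul] at this
  simp [zmodPowHom, this]

theorem exists_pow_ofAdd_one_eq {n : ℕ} [NeZero n] (m : Multiplicative (ZMod n)) :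
    ∃ k : ℕ, m = Multiplicative.ofAdd 1 ^ k :=
  ⟨m.toAdd.val, by
    rw [← ofAdd_nsmul, nsmul_one, ZMod.natCast_zmod_val, ofAdd_toAdd]⟩

namespace BraidAction

/-- The free group of rank two. -/
abbrev F₂ : Type := FreeGroup (Fin 2)

/-- The first basis element of `F₂`. -/
abbrev c : F₂ := FreeGroup.of 0

/-- The second basis element of `F₂`. -/
abbrev d : F₂ := FreeGroup.of 1

/-- The automorphism of `F₂` given by the images of the basis under it and its inverse. -/
def autOfBasis (u v u' v' : F₂)
    (hc : FreeGroup.lift ![u', v'] u = c) (hd : FreeGroup.lift ![u', v'] v = d)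
    (hc' : FreeGroup.lift ![u, v] u' = c) (hd' : FreeGroup.lift ![u, v] v' = d) : MulAut F₂ :=
  MonoidHom.toMulEquiv (FreeGroup.lift ![u, v]) (FreeGroup.lift ![u', v'])
    (by ext i; fin_cases i <;> simp [hc, hd])
    (by ext i; fin_cases i <;> simp [hc', hd'])

/-- The action of `σ₁`. -/
def aut₁ : MulAut F₂ :=
  autOfBasis c (c⁻¹ * d) c (c * d) (by simp) (by simp) (by simp) (by simp)

/-- The action of `σ₂`. -/
def aut₂ : MulAut F₂ :=
  autOfBasis (c * d) d (c * d⁻¹) d (by simp) (by simp) (by simp) (by simp)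

/-- The action of `σ₃`. -/
def aut₃ : MulAut F₂ :=
  autOfBasis c (d * c⁻¹) c (d * c) (by simp) (by simp) (by simp) (by simp)

@[simp] theorem aut₁_c : aut₁ c = c := by simp [aut₁, autOfBasis]
@[simp] theorem aut₁_d : aut₁ d = c⁻¹ * d := by simp [aut₁, autOfBasis]
@[simp] theorem aut₂_c : aut₂ c = c * d := by simp [aut₂, autOfBasis]
@[simp] theorem aut₂_d : aut₂ d = d := by simp [aut₂, autOfBasis]
@[simp] theorem aut₃_c : aut₃ c = c := by simp [aut₃, autOfBasis]
@[simp] theorem aut₃_d : aut₃ d = d * c⁻¹ := by simp [aut₃, autOfBasis]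

theorem mulAut_ext {f g : MulAut F₂} (hc : f c = g c) (hd : f d = g d) : f = g := by
  have : f.toMonoidHom = g.toMonoidHom := by
    ext i; fin_cases i
    · exact hc
    · exact hd
  exact MulEquiv.toMonoidHom_injective this

/-- The action of `B₄` on `F₂`. -/
def action : B₄ →* MulAut F₂ :=
  PresentedGroup.toGroup (f := ![aut₁, aut₂, aut₃]) (by
    rintro r (rfl | rfl | rfl) <;>
      simp only [map_mul, map_inv, FreeGroup.lift_apply_of, mul_inv_eq_one] <;>
      apply mulAut_ext <;> simp [mul_assoc])

theorem action_σ (i : Fin 3) : action (σ i) = ![aut₁, aut₂, aut₃] i :=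
  PresentedGroup.toGroup.of _

theorem action_τ_c : action τ c = d := by simp [τ, action_σ]

theorem action_τ_d : action τ d = c⁻¹ := by simp [τ, action_σ, mul_assoc]

theorem action_θ : action θ = 1 := by
  rw [θ, map_pow]
  apply mulAut_ext <;>
    simp only [pow_succ, pow_zero, one_mul, MulAut.mul_apply, MulAut.one_apply, action_τ_c,
      action_τ_d, map_inv, inv_inv]

theorem action_Δ : action Δ = MulAut.conj c * action τ ^ 2 := by
  apply mulAut_ext <;>
    simp [Δ, τ, action_σ, pow_two, mul_assoc]

end BraidAction

theorem braid_rel₁ : σ 0 * σ 1 * σ 0 = σ 1 * σ 0 * σ 1 :=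
  PresentedGroup.mk_eq_mk_of_mul_inv_mem (rels := braidRels) (Or.inl rfl)

theorem braid_rel₂ : σ 1 * σ 2 * σ 1 = σ 2 * σ 1 * σ 2 :=
  PresentedGroup.mk_eq_mk_of_mul_inv_mem (rels := braidRels) (Or.inr (Or.inl rfl))

theorem braid_comm : σ 0 * σ 2 = σ 2 * σ 0 :=
  PresentedGroup.mk_eq_mk_of_mul_inv_mem (rels := braidRels) (Or.inr (Or.inr rfl))

theorem τ_mul_σ_zero : τ * σ 0 = σ 1 * τ := by
  calc τ * σ 0 = σ 0 * σ 1 * (σ 2 * σ 0) := by simp only [τ, mul_assoc]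
    _ = σ 0 * σ 1 * σ 0 * σ 2 := by rw [← braid_comm]; simp only [mul_assoc]
    _ = σ 1 * τ := by rw [braid_rel₁]; simp only [τ, mul_assoc]

theorem τ_mul_σ_one : τ * σ 1 = σ 2 * τ := by
  calc τ * σ 1 = σ 0 * (σ 1 * σ 2 * σ 1) := by simp only [τ, mul_assoc]
    _ = (σ 0 * σ 2) * σ 1 * σ 2 := by rw [braid_rel₂]; simp only [mul_assoc]
    _ = σ 2 * τ := by rw [braid_comm]; simp only [τ, mul_assoc]

theorem Δ_sq : Δ ^ 2 = τ ^ 4 := by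
  have hΔ : Δ = τ * (σ 0 * σ 1 * σ 0) := by simp only [Δ, τ, mul_assoc]
  have hshift : τ * (σ 0 * σ 1 * σ 0) = σ 1 * σ 2 * σ 1 * τ := by
    rw [← mul_assoc, ← mul_assoc, τ_mul_σ_zero, mul_assoc (σ 1), τ_mul_σ_one, mul_assoc, mul_assoc,
      τ_mul_σ_zero]
    simp only [mul_assoc]
  have key : (σ 0 * σ 1 * σ 0) * (σ 1 * σ 2 * σ 1) = τ * τ := by
    calc (σ 0 * σ 1 * σ 0) * (σ 1 * σ 2 * σ 1)
        = σ 0 * σ 1 * (σ 0 * σ 2) * σ 1 * σ 2 := by rw [braid_rel₂]; simp only [mul_assoc]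
      _ = τ * τ := by rw [braid_comm]; simp only [τ, mul_assoc]
  calc Δ ^ 2 = τ * ((σ 0 * σ 1 * σ 0) * (τ * (σ 0 * σ 1 * σ 0))) := by
        rw [hΔ, pow_two]; simp only [mul_assoc]
    _ = τ * (((σ 0 * σ 1 * σ 0) * (σ 1 * σ 2 * σ 1)) * τ) := by
        rw [hshift]; simp only [mul_assoc]
    _ = τ ^ 4 := by rw [key]; simp only [pow_succ, pow_zero, one_mul, mul_assoc]

namespace BraidAction

/-- The free product `ℤ/4 * ℤ/2`. -/
abbrev P : Type := Monoid.Coprod (Multiplicative (ZMod 4)) (Multiplicative (ZMod 2))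

/-- The generator of order four. -/
def genFour : P := Monoid.Coprod.inl (Multiplicative.ofAdd 1)

/-- The generator of order two. -/
def genTwo : P := Monoid.Coprod.inr (Multiplicative.ofAdd 1)

theorem genFour_pow : genFour ^ 4 = 1 := by
  rw [genFour, ← map_pow, ← ofAdd_nsmul, show (4 : ℕ) • (1 : ZMod 4) = 0 by decide, ofAdd_zero,
    map_one]

theorem genTwo_pow : genTwo ^ 2 = 1 := by
  rw [genTwo, ← map_pow, ← ofAdd_nsmul, show (2 : ℕ) • (1 : ZMod 2) = 0 by decide, ofAdd_zero,
    map_one]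

/-- The free subgroup of index four in `ℤ/4 * ℤ/2`. -/
def freeHom : F₂ →* P := FreeGroup.lift ![genTwo * genFour ^ 2, genFour * genTwo * genFour]

theorem genFour_mul_freeHom (w : F₂) :
    genFour * freeHom w = freeHom (action τ w) * genFour := by
  have h : (MulAut.conj genFour).toMonoidHom.comp freeHom
      = freeHom.comp (action τ).toMonoidHom := by
    ext i
    fin_cases i
    · have : action τ (FreeGroup.of 0) = FreeGroup.of 1 := action_τ_c
      simp [this, freeHom, pow_two, mul_assoc]
    · have : action τ (FreeGroup.of 1) = (FreeGroup.of 0)⁻¹ := action_τ_d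
      have h2 : genTwo⁻¹ = genTwo := inv_eq_of_mul_eq_one_left (by rw [← pow_two, genTwo_pow])
      have h4 : (genFour ^ 2)⁻¹ = genFour ^ 2 :=
        inv_eq_of_mul_eq_one_left (by rw [← pow_add, genFour_pow])
      simp [this, freeHom, mul_assoc, h2, h4]
      simp [pow_two, mul_assoc]
  have := DFunLike.congr_fun h w
  simp only [MonoidHom.comp_apply, MulEquiv.coe_toMonoidHom, MulAut.conj_apply] at this
  rw [← this, inv_mul_cancel_right]

theorem exists_eq_freeHom_mul_pow (g : P) : ∃ (w : F₂) (k : ℕ), g = freeHom w * genFour ^ k := by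
  have hstep : ∀ x : P, (∃ (w : F₂) (k : ℕ), x = freeHom w * genFour ^ k) →
      ∃ (w : F₂) (k : ℕ), genFour * x = freeHom w * genFour ^ k := by
    rintro _ ⟨w, k, rfl⟩
    exact ⟨action τ w, k + 1, by rw [← mul_assoc, genFour_mul_freeHom, pow_succ', mul_assoc]⟩
  have hstep' : ∀ x : P, (∃ (w : F₂) (k : ℕ), x = freeHom w * genFour ^ k) →
      ∃ (w : F₂) (k : ℕ), genTwo * x = freeHom w * genFour ^ k := by
    intro x hx
    obtain ⟨w, k, h⟩ := hstep _ (hstep _ hx)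
    refine ⟨c * w, k, ?_⟩
    have hc : freeHom c = genTwo * genFour ^ 2 := by simp [freeHom]
    have h4 : genFour ^ 2 * (genFour * (genFour * x)) = x := by
      rw [← mul_assoc genFour, ← pow_two, ← mul_assoc, ← pow_add, genFour_pow, one_mul]
    rw [map_mul, mul_assoc, ← h, hc, mul_assoc, h4]
  induction g using Monoid.Coprod.induction_on' with
  | one => exact ⟨1, 0, by simp⟩
  | inl_mul m x ih =>
    obtain ⟨k, rfl⟩ := exists_pow_ofAdd_one_eq m
    rw [map_pow]
    change ∃ (w : F₂) (l : ℕ), genFour ^ k * x = _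
    induction k with
    | zero => simpa using ih
    | succ k hk => rw [pow_succ', mul_assoc]; exact hstep _ hk
  | inr_mul m x ih =>
    obtain ⟨k, rfl⟩ := exists_pow_ofAdd_one_eq m
    rw [map_pow]
    change ∃ (w : F₂) (l : ℕ), genTwo ^ k * x = _
    induction k with
    | zero => simpa using ih
    | succ k hk => rw [pow_succ', mul_assoc]; exact hstep' _ hk

theorem action_τ_pow_four : action τ ^ 4 = 1 := by
  rw [← map_pow]; exact action_θ

/-- An action of `ℤ/4 * ℤ/2` on `F₂` through `τ` and `Δ` is faithful. -/
theorem injective_of_map_generators (f : P →* MulAut F₂) (h4 : f genFour = action τ)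
    (h2 : f genTwo = action Δ) : Function.Injective f := by
  have hconj : f.comp freeHom = MulAut.conj := by
    ext1 i
    fin_cases i
    · simp [freeHom, h4, h2, action_Δ, mul_assoc, ← pow_add, action_τ_pow_four]
    · have hd : action τ * MulAut.conj c * (action τ)⁻¹ = MulAut.conj d := by
        ext1 w
        simp only [MulAut.mul_apply, MulAut.conj_apply, map_mul, map_inv, action_τ_c,
          MulAut.apply_inv_self]
      have h3 : action τ ^ 2 * action τ = (action τ)⁻¹ := by
        rw [eq_inv_iff_mul_eq_one, ← pow_succ, ← pow_succ, action_τ_pow_four]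
      simp [freeHom, h4, h2, action_Δ, mul_assoc, h3]
      simpa [mul_assoc] using hd
  rw [injective_iff_map_eq_one]
  intro g hg
  obtain ⟨w, k, rfl⟩ := exists_eq_freeHom_mul_pow g
  rw [pow_eq_pow_mod k genFour_pow] at hg ⊢
  have hk : k % 4 < 4 := Nat.mod_lt _ (by norm_num)
  generalize k % 4 = k at hg hk
  have hw : ∀ v, w * (action τ ^ k) v * w⁻¹ = v := by
    intro v
    have := DFunLike.congr_fun hg v
    rwa [map_mul, map_pow, h4, ← MonoidHom.comp_apply, hconj, MulAut.mul_apply,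
      MulAut.conj_apply] at this
  let count : F₂ →* Multiplicative ℤ := FreeGroup.lift ![Multiplicative.ofAdd 1, 1]
  have hcc : count c = Multiplicative.ofAdd 1 := by simp [count]
  have hcd : count d = 1 := by simp [count]
  have hcount : count ((action τ ^ k) c) = Multiplicative.ofAdd 1 := by
    have := congrArg count (hw c)
    rwa [map_mul, map_mul, map_inv, mul_inv_cancel_comm, hcc] at this
  interval_cases k
  · have : w = 1 := FreeGroup.eq_one_of_forall_commute_of fun i => by
      have := hw (FreeGroup.of i)
      rw [pow_zero, MulAut.one_apply, mul_inv_eq_iff_eq_mul] at this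
      exact this.symm
    simp [this]
  · rw [pow_one, action_τ_c, hcd] at hcount
    exact absurd hcount (by decide)
  · rw [pow_two, MulAut.mul_apply, action_τ_c, action_τ_d, map_inv, hcc] at hcount
    exact absurd hcount (by decide)
  · rw [pow_succ, pow_two, MulAut.mul_apply, MulAut.mul_apply, action_τ_c, action_τ_d, map_inv,
      map_inv, action_τ_c, hcd] at hcount
    exact absurd hcount (by decide)

end BraidAction

open BraidAction in
/-- Let `G = ⟨τ, Δ⟩ ≤ B₄` and let `Z` be the (central) subgroup of `G` generated by
the full twist `θ = τ⁴ = Δ²`.  Then `G/Z ≅ (ℤ/4ℤ) * (ℤ/2ℤ)`, i.e. `G/Z` has the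
presentation `⟨τ, Δ ∣ τ⁴ = Δ² = 1⟩`. -/
theorem quotient_iso_free_product
    (hθ : θ ∈ Gsub)
    [hZ : (Subgroup.zpowers (⟨θ, hθ⟩ : Gsub)).Normal] :
    Nonempty ((Gsub ⧸ Subgroup.zpowers (⟨θ, hθ⟩ : Gsub)) ≃*
      Monoid.Coprod (Multiplicative (ZMod 4)) (Multiplicative (ZMod 2))) := by
  let N := Subgroup.zpowers (⟨θ, hθ⟩ : Gsub)
  let t : Gsub := ⟨τ, Subgroup.subset_closure (by simp)⟩
  let D : Gsub := ⟨Δ, Subgroup.subset_closure (by simp)⟩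
  have hmk : QuotientGroup.mk' N ⟨θ, hθ⟩ = 1 :=
    (QuotientGroup.eq_one_iff _).2 (Subgroup.mem_zpowers _)
  have ht : QuotientGroup.mk' N t ^ 4 = 1 := by
    rw [← map_pow, ← hmk]; rfl
  have hD : QuotientGroup.mk' N D ^ 2 = 1 := by
    rw [← map_pow, ← hmk]
    exact congrArg _ (Subtype.ext Δ_sq)
  let φ := Monoid.Coprod.lift (zmodPowHom 4 _ ht) (zmodPowHom 2 _ hD)
  have hφ4 : φ genFour = QuotientGroup.mk' N t := zmodPowHom_ofAdd_one 4 _ ht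
  have hφ2 : φ genTwo = QuotientGroup.mk' N D := zmodPowHom_ofAdd_one 2 _ hD
  let ρ : Gsub ⧸ N →* MulAut F₂ := QuotientGroup.lift N (action.comp Gsub.subtype) (by
    intro x hx
    obtain ⟨n, rfl⟩ := Subgroup.mem_zpowers_iff.1 hx
    rw [MonoidHom.mem_ker, map_zpow, MonoidHom.comp_apply, Subgroup.subtype_apply, action_θ, one_zpow])
  have hinj : Function.Injective φ := by
    have : Function.Injective (ρ.comp φ) := by
      apply injective_of_map_generators
      · rw [MonoidHom.comp_apply, hφ4]; rfl
      · rw [MonoidHom.comp_apply, hφ2]; rfl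
    exact Function.Injective.of_comp this
  have hsurj : Function.Surjective φ := by
    have hle : Gsub ≤ (φ.range.comap (QuotientGroup.mk' N)).map Gsub.subtype := by
      refine (Subgroup.closure_le _).2 ?_
      rintro x (rfl | rfl)
      · exact ⟨t, ⟨genFour, hφ4⟩, rfl⟩
      · exact ⟨D, ⟨genTwo, hφ2⟩, rfl⟩
    intro q
    obtain ⟨x, rfl⟩ := QuotientGroup.mk'_surjective N q
    obtain ⟨y, hy, hyx⟩ := hle x.2
    rw [← Subtype.ext hyx]
    exact hy
  exact ⟨(MulEquiv.ofBijective φ ⟨hinj, hsurj⟩).symm⟩
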